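/- Let u : ℝ × ℝ → ℝ be a smooth solution of equation (∗), set m := u − u_{xx}, and let q : ℝ × ℝ → ℝ be continuously differentiable with q(0,x) = x and ∂_t q(t,x) = −2u(t, q(t,x)) for all (t,x). Then for every x ∈ ℝ and every t ≥ 0, m(t, q(t,x)) ≥ m(0,x) · exp(−2∫₀ᵗ (u − 3u_x)(s, q(s,x)) ds). Consequently, if m(0,y) ≥ 0 for all y ∈ ℝ, then m(t, q(t,x)) ≥ 0 for all t ≥ 0 and x ∈ ℝ. -/

import Mathlib

open Real MeasureTheory Set Filter

/-- Partial derivative of `u` with respect to the first (time) variable. -/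
noncomputable def ut (u : ℝ × ℝ → ℝ) (t x : ℝ) : ℝ := deriv (fun s => u (s, x)) t
/-- Partial derivative of `u` with respect to the second (spatial) variable. -/
noncomputable def ux (u : ℝ × ℝ → ℝ) (t x : ℝ) : ℝ := deriv (fun y => u (t, y)) x
noncomputable def uxx (u : ℝ × ℝ → ℝ) (t x : ℝ) : ℝ := deriv (fun y => ux u t y) x
noncomputable def uxxx (u : ℝ × ℝ → ℝ) (t x : ℝ) : ℝ := deriv (fun y => uxx u t y) x
noncomputable def utx (u : ℝ × ℝ → ℝ) (t x : ℝ) : ℝ := deriv (fun y => ut u t y) x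
noncomputable def utxx (u : ℝ × ℝ → ℝ) (t x : ℝ) : ℝ := deriv (fun y => utx u t y) x

/-- `u` satisfies the Novikov-type equation (∗) at the point `(t, x)`. -/
def SolvesAt (u : ℝ × ℝ → ℝ) (t x : ℝ) : Prop :=
  ut u t x - utxx u t x =
    4 * u (t, x) * ux u t x + 2 * (ux u t x) ^ 2 + 2 * u (t, x) * uxx u t x
      - 6 * ux u t x * uxx u t x - 2 * u (t, x) * uxxx u t x

/-- `u` is a solution of the Novikov-type equation (∗) on all of `ℝ × ℝ`. -/
def IsSolution (u : ℝ × ℝ → ℝ) : Prop := ∀ t x : ℝ, SolvesAt u t x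

section SliceDerivatives

variable {f : ℝ × ℝ → ℝ}

theorem ux_eq_fderiv (hf : Differentiable ℝ f) (p : ℝ × ℝ) :
    ux f p.1 p.2 = fderiv ℝ f p (0, 1) :=
  ((hf p).hasFDerivAt.comp_hasDerivAt p.2
    ((hasDerivAt_const p.2 p.1).prodMk (hasDerivAt_id p.2))).deriv

theorem ut_eq_fderiv (hf : Differentiable ℝ f) (p : ℝ × ℝ) :
    ut f p.1 p.2 = fderiv ℝ f p (1, 0) :=
  ((hf p).hasFDerivAt.comp_hasDerivAt p.1
    ((hasDerivAt_id p.1).prodMk (hasDerivAt_const p.1 p.2))).deriv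

theorem contDiff_fderiv_apply_const (hf : ContDiff ℝ (⊤ : ℕ∞) f) (v : ℝ × ℝ) :
    ContDiff ℝ (⊤ : ℕ∞) (fun p => fderiv ℝ f p v) :=
  (hf.fderiv_right (m := (⊤ : ℕ∞)) (by simp)).clm_apply contDiff_const

theorem differentiable_of_smooth (hf : ContDiff ℝ (⊤ : ℕ∞) f) : Differentiable ℝ f :=
  hf.differentiable (by simp)

theorem contDiff_ux (hf : ContDiff ℝ (⊤ : ℕ∞) f) :
    ContDiff ℝ (⊤ : ℕ∞) (fun p : ℝ × ℝ => ux f p.1 p.2) := by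
  simpa only [ux_eq_fderiv (differentiable_of_smooth hf)] using contDiff_fderiv_apply_const hf (0, 1)

theorem contDiff_ut (hf : ContDiff ℝ (⊤ : ℕ∞) f) :
    ContDiff ℝ (⊤ : ℕ∞) (fun p : ℝ × ℝ => ut f p.1 p.2) := by
  simpa only [ut_eq_fderiv (differentiable_of_smooth hf)] using contDiff_fderiv_apply_const hf (1, 0)

theorem ux_ut_comm (hf : ContDiff ℝ (⊤ : ℕ∞) f) (t x : ℝ) :
    ux (fun p => ut f p.1 p.2) t x = ut (fun p => ux f p.1 p.2) t x := by
  have hd := differentiable_of_smooth hf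
  have hd' : Differentiable ℝ (fderiv ℝ f) :=
    (hf.fderiv_right (m := (⊤ : ℕ∞)) (by simp)).differentiable (by simp)
  have hsymm : IsSymmSndFDerivAt ℝ f (t, x) :=
    hf.contDiffAt.isSymmSndFDerivAt <| by
      simpa using WithTop.coe_le_coe.2 (le_top : (2 : ℕ∞) ≤ ⊤)
  have key (v w : ℝ × ℝ) : fderiv ℝ (fun p => fderiv ℝ f p v) (t, x) w
      = fderiv ℝ (fderiv ℝ f) (t, x) w v := by
    rw [fderiv_clm_apply (hd' _) (differentiableAt_const v)]
    simp
  rw [ux_eq_fderiv (differentiable_of_smooth (contDiff_ut hf)) (t, x),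
    ut_eq_fderiv (differentiable_of_smooth (contDiff_ux hf)) (t, x)]
  simp only [ux_eq_fderiv hd, ut_eq_fderiv hd, key]
  exact hsymm _ _

theorem hasDerivAt_along_curve (hf : Differentiable ℝ f) {c : ℝ → ℝ} {c' t : ℝ}
    (hc : HasDerivAt c c' t) :
    HasDerivAt (fun s => f (s, c s)) (ut f t (c t) + c' * ux f t (c t)) t := by
  have h := (hf (t, c t)).hasFDerivAt.comp_hasDerivAt t ((hasDerivAt_id t).prodMk hc)
  refine h.congr_deriv ?_
  rw [ut_eq_fderiv hf (t, c t), ux_eq_fderiv hf (t, c t), ← smul_eq_mul c', ← map_smul, ← map_add]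
  simp

end SliceDerivatives

/-- A Grönwall-type lower bound for the linear differential inequality `y' ≥ -2 a y`. -/
theorem mul_exp_integral_le_of_deriv_ge {a y y' : ℝ → ℝ} (ha : Continuous a)
    (hy : ∀ t, HasDerivAt y (y' t) t) (hle : ∀ t, -2 * a t * y t ≤ y' t) {t : ℝ} (ht : 0 ≤ t) :
    y 0 * exp (-2 * ∫ s in (0 : ℝ)..t, a s) ≤ y t := by
  have hA (t : ℝ) : HasDerivAt (fun t => ∫ s in (0 : ℝ)..t, a s) (a t) t :=
    ha.integral_hasStrictDerivAt 0 t |>.hasDerivAt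
  have hF (t : ℝ) := (hy t).mul ((hA t).const_mul 2).exp
  have hmono := monotone_of_hasDerivAt_nonneg hF fun t => by
    have := mul_nonneg (sub_nonneg.2 (hle t)) (exp_pos (2 * ∫ s in (0 : ℝ)..t, a s)).le
    change 0 ≤ _
    linarith
  have h := hmono ht
  simp only [Pi.mul_apply, intervalIntegral.integral_same, mul_zero, exp_zero, mul_one] at h
  rwa [neg_mul, exp_neg, ← div_eq_mul_inv, div_le_iff₀ (exp_pos _)]

/-- The momentum equation `m_t - 2 u m_x = -2 (u - 3 u_x) m + 2 (u - u_x)²` along a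
characteristic `c`. -/
theorem hasDerivAt_momentum {u : ℝ × ℝ → ℝ} (hu : ContDiff ℝ (⊤ : ℕ∞) u) (hsol : IsSolution u)
    {c : ℝ → ℝ} {t : ℝ} (hc : HasDerivAt c (-2 * u (t, c t)) t) :
    HasDerivAt (fun s => u (s, c s) - uxx u s (c s))
      (-2 * (u (t, c t) - 3 * ux u t (c t)) * (u (t, c t) - uxx u t (c t))
        + 2 * (u (t, c t) - ux u t (c t)) ^ 2) t := by
  have hux := contDiff_ux hu
  have huxx : ContDiff ℝ (⊤ : ℕ∞) (fun p : ℝ × ℝ => uxx u p.1 p.2) := contDiff_ux hux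
  have hcomm : utxx u t (c t) = ut (fun p => uxx u p.1 p.2) t (c t) := by
    have h : utx u t = fun y => ut (fun p => ux u p.1 p.2) t y :=
      funext fun y => ux_ut_comm hu t y
    calc utxx u t (c t) = ux (fun p => ut (fun p => ux u p.1 p.2) p.1 p.2) t (c t) :=
          congrArg (fun g => deriv g (c t)) h
      _ = _ := ux_ut_comm hux t (c t)
  have hxxx : ux (fun p => uxx u p.1 p.2) t (c t) = uxxx u t (c t) := rfl
  have h := (hasDerivAt_along_curve (differentiable_of_smooth hu) hc).sub
    (hasDerivAt_along_curve (differentiable_of_smooth huxx) hc)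
  refine h.congr_deriv ?_
  have hs : SolvesAt u t (c t) := hsol t (c t)
  rw [SolvesAt, hcomm] at hs
  rw [hxxx]
  linear_combination hs

/-- Inequality (4.0.7): along the characteristic flow `q` of a smooth solution `u` of (∗),
the momentum `m = u − u_xx` satisfies
`m (t, q (t, x)) ≥ m (0, x) · exp (−2 ∫₀ᵗ (u − 3 u_x)(s, q (s, x)) ds)` for `t ≥ 0`;
consequently, if `m (0, ·) ≥ 0` then `m (t, q (t, x)) ≥ 0` for all `t ≥ 0`, `x ∈ ℝ`. -/
theorem momentum_positivity (u : ℝ × ℝ → ℝ) (hu : ContDiff ℝ (⊤ : ℕ∞) u)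
    (hsol : IsSolution u) (q : ℝ × ℝ → ℝ) (hq : ContDiff ℝ 1 q)
    (hq0 : ∀ x : ℝ, q (0, x) = x)
    (hqt : ∀ t x : ℝ, deriv (fun s => q (s, x)) t = -2 * u (t, q (t, x))) :
    (∀ x t : ℝ, 0 ≤ t →
      (u (0, x) - uxx u 0 x) *
          Real.exp (-2 * ∫ s in (0:ℝ)..t, (u (s, q (s, x)) - 3 * ux u s (q (s, x))))
        ≤ u (t, q (t, x)) - uxx u t (q (t, x))) ∧
      ((∀ y : ℝ, 0 ≤ u (0, y) - uxx u 0 y) →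
        ∀ t x : ℝ, 0 ≤ t → 0 ≤ u (t, q (t, x)) - uxx u t (q (t, x))) := by
  have hq' (t x : ℝ) : HasDerivAt (fun s => q (s, x)) (-2 * u (t, q (t, x))) t := by
    rw [← hqt t x]
    exact (((hq.differentiable one_ne_zero).comp
      (differentiable_id.prodMk (differentiable_const x))) t).hasDerivAt
  have bound (x t : ℝ) (ht : 0 ≤ t) :
      (u (0, x) - uxx u 0 x) *
          Real.exp (-2 * ∫ s in (0:ℝ)..t, (u (s, q (s, x)) - 3 * ux u s (q (s, x))))
        ≤ u (t, q (t, x)) - uxx u t (q (t, x)) := by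
    have hcurve : Continuous fun s : ℝ => (s, q (s, x)) :=
      continuous_id.prodMk (hq.continuous.comp (continuous_id.prodMk continuous_const))
    have ha : Continuous fun s => u (s, q (s, x)) - 3 * ux u s (q (s, x)) :=
      (hu.continuous.comp hcurve).sub
        (continuous_const.mul ((contDiff_ux hu).continuous.comp hcurve))
    have h := mul_exp_integral_le_of_deriv_ge ha
      (fun t => hasDerivAt_momentum hu hsol (hq' t x))
      (fun t => le_add_of_nonneg_right (by positivity)) ht
    simpa only [hq0] using h
  exact ⟨bound, fun h0 t x ht =>
    (mul_nonneg (h0 x) (exp_pos _).le).trans (bound x t ht)⟩
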